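/- The Value of Unilateral Altruism is arbitrarily large in the n-user routing game on the load-balancing network with uniform cross-link splitting: for every integer n ≥ 2, every r > 0, L > 0 and every M > 0, there exist δ, c with 0 < δ < L < c and cδ < rL, a degree of cooperation β ∈ (0, 1], a Nash equilibrium q of the altruistic game (where user 1 minimizes Ĵ₁ = (1 − β)J₁ + (β/(n − 1))·Σ_{j ≠ 1} J_j and every user j ≠ 1 minimizes J_j), and a Nash equilibrium p of the selfish game (every user i minimizes Jᵢ), such that J₁(p) > M · J₁(q). -/

import Mathlib

open Finset

/-- Elbow latency function with parameters `r, L, δ`. -/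
noncomputable def T (r L δ x : ℝ) : ℝ := max 0 (L / δ * (x - r) + L)

/-- Total flow on local link `j` under profile `p` (uniform cross-link splitting). -/
noncomputable def flow (n : ℕ) (r : ℝ) (p : Fin n → ℝ) (j : Fin n) : ℝ :=
  p j + ∑ i ∈ Finset.univ.erase j, (r - p i) / ((n : ℝ) - 1)

/-- Cost of user `i` in the `n`-user load-balancing game with uniform cross-link splitting. -/
noncomputable def J (n : ℕ) (r L δ c : ℝ) (p : Fin n → ℝ) (i : Fin n) : ℝ :=
  p i * T r L δ (flow n r p i) +
    ∑ j ∈ Finset.univ.erase i, (r - p i) / ((n : ℝ) - 1) * (c + T r L δ (flow n r p j))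
/-- Perceived cost of the unilaterally altruistic user `i₀` with
degree of cooperation `β`. -/
noncomputable def Jhat (n : ℕ) (r L δ c β : ℝ) (i₀ : Fin n) (p : Fin n → ℝ) : ℝ :=
  (1 - β) * J n r L δ c p i₀ +
    β / ((n : ℝ) - 1) * ∑ j ∈ Finset.univ.erase i₀, J n r L δ c p j

lemma T_nonneg (r L δ x : ℝ) : 0 ≤ T r L δ x := le_max_left _ _

lemma le_T (r L δ x : ℝ) : L / δ * (x - r) + L ≤ T r L δ x := le_max_right _ _

/-- Flows only depend on a strategy and on the total flow sent over cross links. -/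
lemma flow_eq (n : ℕ) (r : ℝ) (p : Fin n → ℝ) (j : Fin n) :
    flow n r p j = p j + ((∑ i, (r - p i)) - (r - p j)) / ((n : ℝ) - 1) := by
  unfold flow
  rw [← Finset.sum_div, ← Finset.add_sum_erase _ _ (Finset.mem_univ j)]
  ring

lemma sum_sub_update (n : ℕ) (r : ℝ) (p : Fin n → ℝ) (i : Fin n) (y : ℝ) :
    ∑ k, (r - Function.update p i y k) = (∑ k, (r - p k)) + p i - y := by
  rw [← Finset.add_sum_erase _ _ (Finset.mem_univ i),
    ← Finset.add_sum_erase _ (fun k => r - p k) (Finset.mem_univ i),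
    Finset.sum_congr rfl fun k hk => by
      rw [Function.update_of_ne (Finset.ne_of_mem_erase hk)]]
  simp only [Function.update_self]
  ring

/-- If all latencies on the links `k ≠ i` are at least `B` and the latency on link `i` is at
least `A`, the cost of user `i` is bounded below accordingly. -/
lemma le_J (n : ℕ) (hn : 2 ≤ n) (r L δ c A B : ℝ) (p : Fin n → ℝ) (i : Fin n)
    (hp : p i ∈ Set.Icc 0 r) (hA : A ≤ T r L δ (flow n r p i))
    (hB : ∀ k, k ≠ i → B ≤ T r L δ (flow n r p k)) :
    p i * A + (r - p i) * (c + B) ≤ J n r L δ c p i := by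
  have hm : (0 : ℝ) < (n : ℝ) - 1 := by
    have : (2 : ℝ) ≤ n := by exact_mod_cast hn
    linarith
  have hsum : ∑ _k ∈ Finset.univ.erase i, (r - p i) / ((n : ℝ) - 1) * (c + B) ≤
      ∑ k ∈ Finset.univ.erase i, (r - p i) / ((n : ℝ) - 1) * (c + T r L δ (flow n r p k)) := by
    refine Finset.sum_le_sum fun k hk => mul_le_mul_of_nonneg_left ?_
      (div_nonneg (sub_nonneg.2 hp.2) hm.le)
    linarith [hB k (Finset.ne_of_mem_erase hk)]
  rw [Finset.sum_const, Finset.card_erase_of_mem (Finset.mem_univ i), Finset.card_univ,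
    Fintype.card_fin, nsmul_eq_mul, Nat.cast_sub (by omega), Nat.cast_one, ← mul_assoc,
    mul_div_cancel₀ _ (ne_of_gt hm)] at hsum
  have := mul_le_mul_of_nonneg_left hA hp.1
  unfold J
  linarith

/-- Equality version of `le_J`. -/
lemma J_eq (n : ℕ) (hn : 2 ≤ n) (r L δ c A B : ℝ) (p : Fin n → ℝ) (i : Fin n)
    (hA : T r L δ (flow n r p i) = A)
    (hB : ∀ k, k ≠ i → T r L δ (flow n r p k) = B) :
    J n r L δ c p i = p i * A + (r - p i) * (c + B) := by
  have hm : (0 : ℝ) < (n : ℝ) - 1 := by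
    have : (2 : ℝ) ≤ n := by exact_mod_cast hn
    linarith
  unfold J
  rw [hA, Finset.sum_congr rfl fun k hk => by rw [hB k (Finset.ne_of_mem_erase hk)],
    Finset.sum_const, Finset.card_erase_of_mem (Finset.mem_univ i), Finset.card_univ,
    Fintype.card_fin, nsmul_eq_mul, Nat.cast_sub (by omega), Nat.cast_one, ← mul_assoc,
    mul_div_cancel₀ _ (ne_of_gt hm)]

/-- Cost of user `j` with the contribution of one other link `o` singled out. -/
lemma J_eq_single_out (n : ℕ) (r L δ c : ℝ) (p : Fin n → ℝ) {o j : Fin n} (hj : j ≠ o) :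
    J n r L δ c p j = p j * T r L δ (flow n r p j) +
      ((r - p j) / ((n : ℝ) - 1) * (c + T r L δ (flow n r p o)) +
        ∑ k ∈ (Finset.univ.erase j).erase o,
          (r - p j) / ((n : ℝ) - 1) * (c + T r L δ (flow n r p k))) := by
  unfold J
  rw [Finset.add_sum_erase _ (fun k => (r - p j) / ((n : ℝ) - 1) * (c + T r L δ (flow n r p k)))
    (Finset.mem_erase.2 ⟨hj.symm, Finset.mem_univ o⟩)]

lemma card_erase_erase (n : ℕ) (hn : 2 ≤ n) {o j : Fin n} (hj : j ≠ o) :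
    ((((Finset.univ.erase j).erase o).card : ℕ) : ℝ) = (n : ℝ) - 2 := by
  rw [Finset.card_erase_of_mem (Finset.mem_erase.2 ⟨hj.symm, Finset.mem_univ o⟩),
    Finset.card_erase_of_mem (Finset.mem_univ j), Finset.card_univ, Fintype.card_fin, Nat.sub_sub,
    Nat.cast_sub (by omega)]
  norm_num

/-- Lower bound on the cost of user `j` from separate latency bounds on link `j`, on a
distinguished link `o ≠ j`, and on all remaining links. -/
lemma le_J_single_out (n : ℕ) (hn : 2 ≤ n) (r L δ c A B C : ℝ) (p : Fin n → ℝ) {o j : Fin n}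
    (hj : j ≠ o) (hp : p j ∈ Set.Icc 0 r) (hA : A ≤ T r L δ (flow n r p j))
    (hB : B ≤ T r L δ (flow n r p o))
    (hC : ∀ k, k ≠ j → k ≠ o → C ≤ T r L δ (flow n r p k)) :
    p j * A + (r - p j) / ((n : ℝ) - 1) * ((c + B) + ((n : ℝ) - 2) * (c + C)) ≤
      J n r L δ c p j := by
  have hm : (0 : ℝ) < (n : ℝ) - 1 := by
    have : (2 : ℝ) ≤ n := by exact_mod_cast hn
    linarith
  have ha : 0 ≤ (r - p j) / ((n : ℝ) - 1) := div_nonneg (sub_nonneg.2 hp.2) hm.le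
  have hsum : ∑ _k ∈ (Finset.univ.erase j).erase o, (r - p j) / ((n : ℝ) - 1) * (c + C) ≤
      ∑ k ∈ (Finset.univ.erase j).erase o,
        (r - p j) / ((n : ℝ) - 1) * (c + T r L δ (flow n r p k)) := by
    refine Finset.sum_le_sum fun k hk => mul_le_mul_of_nonneg_left ?_ ha
    have hk' := Finset.mem_erase.1 hk
    linarith [hC k (Finset.ne_of_mem_erase hk'.2) hk'.1]
  rw [Finset.sum_const, nsmul_eq_mul, card_erase_erase n hn hj] at hsum
  have h1 := mul_le_mul_of_nonneg_left hA hp.1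
  have h2 := mul_le_mul_of_nonneg_left hB ha
  rw [J_eq_single_out n r L δ c p hj]
  linarith

/-- Equality version of `le_J_single_out`. -/
lemma J_eq_of_latencies (n : ℕ) (hn : 2 ≤ n) (r L δ c A B C : ℝ) (p : Fin n → ℝ) {o j : Fin n}
    (hj : j ≠ o) (hA : T r L δ (flow n r p j) = A) (hB : T r L δ (flow n r p o) = B)
    (hC : ∀ k, k ≠ j → k ≠ o → T r L δ (flow n r p k) = C) :
    J n r L δ c p j =
      p j * A + (r - p j) / ((n : ℝ) - 1) * ((c + B) + ((n : ℝ) - 2) * (c + C)) := by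
  rw [J_eq_single_out n r L δ c p hj, hA, hB, Finset.sum_congr rfl fun k hk => by
    rw [hC k (Finset.ne_of_mem_erase (Finset.mem_erase.1 hk).2) (Finset.mem_erase.1 hk).1],
    Finset.sum_const, nsmul_eq_mul, card_erase_erase n hn hj]
  ring

section Selfish

variable (n : ℕ) (r L δ : ℝ) (x : ℝ)

lemma flow_const (hn : 2 ≤ n) (k : Fin n) : flow n r (fun _ => r - x) k = r := by
  have hm : (n : ℝ) - 1 ≠ 0 := by
    have : (2 : ℝ) ≤ n := by exact_mod_cast hn
    linarith
  rw [flow_eq]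
  simp only [sub_sub_cancel, Finset.sum_const, Finset.card_univ, Fintype.card_fin, nsmul_eq_mul]
  field_simp
  ring

lemma J_const (hn : 2 ≤ n) (hL : 0 < L) (c : ℝ) (i : Fin n) :
    J n r L δ c (fun _ => r - x) i = r * L + x * c := by
  have hT : T r L δ r = L := by simp [T, hL.le]
  rw [J_eq n hn r L δ c L L _ i (by rw [flow_const n r x hn, hT])
    fun k _ => by rw [flow_const n r x hn, hT]]
  ring

/-- A symmetric profile satisfying the first-order condition is a selfish equilibrium. -/
lemma J_const_le_update (hn : 2 ≤ n) (hL : 0 < L) (hδ : 0 < δ) (c : ℝ)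
    (hx : n * x * L = (n - 1) * (r * L - c * δ)) (i : Fin n) (y : ℝ) (hy : y ∈ Set.Icc 0 r) :
    J n r L δ c (fun _ => r - x) i ≤ J n r L δ c (Function.update (fun _ => r - x) i y) i := by
  have hm : (0 : ℝ) < (n : ℝ) - 1 := by
    have : (2 : ℝ) ≤ n := by exact_mod_cast hn
    linarith
  set m : ℝ := (n : ℝ) - 1 with hmdef
  have hS : ∑ k, (r - Function.update (fun _ : Fin n => r - x) i y k) =
      (n : ℝ) * x + (r - x) - y := by
    rw [sum_sub_update]; simp
  have hi : flow n r (Function.update (fun _ => r - x) i y) i = r + (y - (r - x)) := by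
    rw [flow_eq, hS, Function.update_self, ← hmdef, show (n : ℝ) = m + 1 by rw [hmdef]; ring]
    field_simp
    ring
  have hk : ∀ k, k ≠ i →
      flow n r (Function.update (fun _ => r - x) i y) k = r - (y - (r - x)) / m := by
    intro k hk
    rw [flow_eq, hS, Function.update_of_ne hk, ← hmdef, show (n : ℝ) = m + 1 by rw [hmdef]; ring]
    field_simp
    ring
  refine le_trans ?_ (le_J n hn r L δ c (L / δ * (y - (r - x)) + L)
    (L / δ * (-((y - (r - x)) / m)) + L) _ i (by simpa using hy) ?_ ?_)
  · rw [J_const n r L δ x hn hL, Function.update_self]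
    have hc : c = L / δ * (r - (m + 1) * x / m) := by
      rw [show (n : ℝ) = m + 1 by rw [hmdef]; ring] at hx
      field_simp
      linarith
    have key : y * (L / δ * (y - (r - x)) + L) +
        (r - y) * (c + (L / δ * (-((y - (r - x)) / m)) + L)) - (r * L + x * c) =
        L / δ * (1 + 1 / m) * (y - (r - x)) ^ 2 := by
      rw [hc]
      field_simp
      ring
    have : 0 ≤ L / δ * (1 + 1 / m) * (y - (r - x)) ^ 2 := by positivity
    linarith
  · rw [hi]
    convert le_T r L δ _ using 2
    ring
  · intro k hk'
    rw [hk k hk']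
    convert le_T r L δ _ using 2
    ring

end Selfish

/-- User `o` keeps his whole demand local; every other user diverts `(n - 1) * δ`. -/
noncomputable def altruisticProfile (n : ℕ) (r δ : ℝ) (o : Fin n) : Fin n → ℝ :=
  fun i => if i = o then r else r - ((n : ℝ) - 1) * δ

section Altruistic

variable (n : ℕ) (r L δ : ℝ) (o : Fin n)

lemma altruisticProfile_self : altruisticProfile n r δ o o = r := if_pos rfl

lemma altruisticProfile_of_ne {j : Fin n} (hj : j ≠ o) :
    altruisticProfile n r δ o j = r - ((n : ℝ) - 1) * δ := if_neg hj

lemma sum_sub_altruisticProfile (hn : 2 ≤ n) :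
    ∑ k, (r - altruisticProfile n r δ o k) = ((n : ℝ) - 1) * (((n : ℝ) - 1) * δ) := by
  rw [← Finset.add_sum_erase _ _ (Finset.mem_univ o), altruisticProfile_self,
    Finset.sum_congr rfl fun k hk => by
      rw [altruisticProfile_of_ne n r δ o (Finset.ne_of_mem_erase hk)],
    Finset.sum_const, Finset.card_erase_of_mem (Finset.mem_univ o), Finset.card_univ,
    Fintype.card_fin, nsmul_eq_mul, Nat.cast_sub (by omega)]
  simp

lemma flow_altruisticProfile_self (hn : 2 ≤ n) :
    flow n r (altruisticProfile n r δ o) o = r + ((n : ℝ) - 1) * δ := by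
  have hm : (n : ℝ) - 1 ≠ 0 := by
    have : (2 : ℝ) ≤ n := by exact_mod_cast hn
    linarith
  rw [flow_eq, sum_sub_altruisticProfile n r δ o hn, altruisticProfile_self]
  field_simp
  ring

lemma flow_altruisticProfile_of_ne (hn : 2 ≤ n) {j : Fin n} (hj : j ≠ o) :
    flow n r (altruisticProfile n r δ o) j = r - δ := by
  have hm : (n : ℝ) - 1 ≠ 0 := by
    have : (2 : ℝ) ≤ n := by exact_mod_cast hn
    linarith
  rw [flow_eq, sum_sub_altruisticProfile n r δ o hn, altruisticProfile_of_ne n r δ o hj]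
  field_simp
  ring

lemma T_altruisticProfile_self (hn : 2 ≤ n) (hL : 0 < L) (hδ : 0 < δ) :
    T r L δ (flow n r (altruisticProfile n r δ o) o) = n * L := by
  rw [flow_altruisticProfile_self n r δ o hn, T,
    show L / δ * (r + ((n : ℝ) - 1) * δ - r) + L = n * L by field_simp; ring]
  exact max_eq_right (by positivity)

lemma T_altruisticProfile_of_ne (hn : 2 ≤ n) (hδ : 0 < δ) {j : Fin n} (hj : j ≠ o) :
    T r L δ (flow n r (altruisticProfile n r δ o) j) = 0 := by
  rw [flow_altruisticProfile_of_ne n r δ o hn hj, T,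
    show L / δ * (r - δ - r) + L = 0 by field_simp; ring, max_self]

lemma J_altruisticProfile_self (hn : 2 ≤ n) (hL : 0 < L) (hδ : 0 < δ) (c : ℝ) :
    J n r L δ c (altruisticProfile n r δ o) o = r * (n * L) := by
  rw [J_eq n hn r L δ c (n * L) 0 _ o (T_altruisticProfile_self n r L δ o hn hL hδ)
    fun k hk => T_altruisticProfile_of_ne n r L δ o hn hδ hk, altruisticProfile_self]
  ring

lemma J_altruisticProfile_of_ne (hn : 2 ≤ n) (hL : 0 < L) (hδ : 0 < δ) (c : ℝ) {j : Fin n}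
    (hj : j ≠ o) :
    J n r L δ c (altruisticProfile n r δ o) j = ((n : ℝ) - 1) * δ * c + δ * (n * L) := by
  have hm : (n : ℝ) - 1 ≠ 0 := by
    have : (2 : ℝ) ≤ n := by exact_mod_cast hn
    linarith
  rw [J_eq_of_latencies n hn r L δ c 0 (n * L) 0 _ hj
    (T_altruisticProfile_of_ne n r L δ o hn hδ hj) (T_altruisticProfile_self n r L δ o hn hL hδ)
    fun k _ hk => T_altruisticProfile_of_ne n r L δ o hn hδ hk, altruisticProfile_of_ne n r δ o hj]
  field_simp
  ring

/-- Diverting flow of user `o` cannot lower the cost of any other user. -/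
lemma J_altruisticProfile_le_update_altruist (hn : 2 ≤ n) (hL : 0 < L) (hδ : 0 < δ)
    (hδr : n * δ ≤ r) (c : ℝ) {j : Fin n} (hj : j ≠ o) (y : ℝ) (hy : y ∈ Set.Icc 0 r) :
    J n r L δ c (altruisticProfile n r δ o) j ≤
      J n r L δ c (Function.update (altruisticProfile n r δ o) o y) j := by
  have hm : (0 : ℝ) < (n : ℝ) - 1 := by
    have : (2 : ℝ) ≤ n := by exact_mod_cast hn
    linarith
  set m : ℝ := (n : ℝ) - 1 with hmdef
  have hnm : (n : ℝ) = m + 1 := by rw [hmdef]; ring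
  have hpj : Function.update (altruisticProfile n r δ o) o y j = r - m * δ := by
    rw [Function.update_of_ne hj, altruisticProfile_of_ne n r δ o hj]
  have hS : ∑ k, (r - Function.update (altruisticProfile n r δ o) o y k) =
      m * (m * δ) + r - y := by
    rw [sum_sub_update, sum_sub_altruisticProfile n r δ o hn, altruisticProfile_self]
  have hk : ∀ k, k ≠ o → L / δ * ((r - y) / m) ≤
      T r L δ (flow n r (Function.update (altruisticProfile n r δ o) o y) k) := by
    intro k hk
    refine le_of_eq_of_le ?_ (le_T r L δ _)
    rw [flow_eq, hS, Function.update_of_ne hk, altruisticProfile_of_ne n r δ o hk, ← hmdef]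
    field_simp
    ring
  refine le_trans ?_ (le_J_single_out n hn r L δ c (L / δ * ((r - y) / m))
    (n * L - L / δ * (r - y)) (L / δ * ((r - y) / m)) _ hj ?_ (hk j hj) ?_ fun k _ hko => hk k hko)
  · rw [J_altruisticProfile_of_ne n r L δ o hn hL hδ c hj, hpj, ← hmdef, hnm]
    rw [hnm] at hδr
    have key : (r - m * δ) * (L / δ * ((r - y) / m)) + (r - (r - m * δ)) / m *
        (c + ((m + 1) * L - L / δ * (r - y)) + (m + 1 - 2) * (c + L / δ * ((r - y) / m))) -
        (m * δ * c + δ * ((m + 1) * L)) = L / δ * ((r - y) / m) * (r - (m + 1) * δ) := by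
      field_simp
      ring
    have : 0 ≤ L / δ * ((r - y) / m) * (r - (m + 1) * δ) :=
      mul_nonneg (mul_nonneg (by positivity) (div_nonneg (by linarith [hy.2]) hm.le))
        (by linarith)
    linarith
  · rw [hpj]
    rw [hnm] at hδr
    have : 0 < m * δ := by positivity
    constructor <;> linarith
  · refine le_of_eq_of_le ?_ (le_T r L δ _)
    rw [flow_eq, hS, Function.update_self, ← hmdef, hnm]
    field_simp
    ring

/-- Every selfish user plays a best response at the elbow of his own link. -/
lemma J_altruisticProfile_le_update_selfish (hn : 2 ≤ n) (hL : 0 < L) (hδ : 0 < δ) (c : ℝ)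
    (hc : 0 ≤ c) (hcr : c * δ + 2 * n * L * δ ≤ r * L) {j : Fin n} (hj : j ≠ o) (y : ℝ)
    (hy : y ∈ Set.Icc 0 r) :
    J n r L δ c (altruisticProfile n r δ o) j ≤
      J n r L δ c (Function.update (altruisticProfile n r δ o) j y) j := by
  have hn' : (2 : ℝ) ≤ n := by exact_mod_cast hn
  have hm : (0 : ℝ) < (n : ℝ) - 1 := by linarith
  set m : ℝ := (n : ℝ) - 1 with hmdef
  have hnm : (n : ℝ) = m + 1 := by rw [hmdef]; ring
  have hm1 : 1 ≤ m := by linarith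
  obtain ⟨x, rfl⟩ : ∃ x, y = r - x := ⟨r - y, by ring⟩
  have hx0 : 0 ≤ x := by linarith [hy.2]
  have hS : ∑ k, (r - Function.update (altruisticProfile n r δ o) j (r - x) k) =
      m * (m * δ) + x - m * δ := by
    rw [sum_sub_update, sum_sub_altruisticProfile n r δ o hn, altruisticProfile_of_ne n r δ o hj]
    ring
  have ho : n * L + L / δ * ((x - m * δ) / m) ≤
      T r L δ (flow n r (Function.update (altruisticProfile n r δ o) j (r - x)) o) := by
    refine le_of_eq_of_le ?_ (le_T r L δ _)
    rw [flow_eq, hS, Function.update_of_ne hj.symm, altruisticProfile_self, ← hmdef, hnm]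
    field_simp
    ring
  have hbound := fun A hA => le_J_single_out n hn r L δ c A _ 0
    (Function.update (altruisticProfile n r δ o) j (r - x)) hj (by simpa using hy) hA ho
    fun k _ _ => T_nonneg _ _ _ _
  rw [J_altruisticProfile_of_ne n r L δ o hn hL hδ c hj]
  simp only [Function.update_self, hnm, sub_sub_cancel, add_sub_cancel_right] at hbound ⊢
  rw [hnm] at hcr
  rcases le_total (m * δ) x with hx | hx
  · refine le_trans ?_ (hbound 0 (T_nonneg _ _ _ _))
    have key : (r - x) * 0 + x / m * (c + ((m + 1) * L + L / δ * ((x - m * δ) / m)) +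
        (m + 1 - 2) * (c + 0)) - (m * δ * c + δ * ((m + 1) * L)) =
        (x - m * δ) * (c + (m + 1) * L / m + x * L / δ / m ^ 2) := by
      field_simp
      ring
    have : 0 ≤ (x - m * δ) * (c + (m + 1) * L / m + x * L / δ / m ^ 2) :=
      mul_nonneg (by linarith) (by positivity)
    linarith
  · refine le_trans ?_ (hbound (L / δ * (m * δ - x)) (le_of_eq_of_le ?_ (le_T r L δ _)))
    · have key : (r - x) * (L / δ * (m * δ - x)) +
          x / m * (c + ((m + 1) * L + L / δ * ((x - m * δ) / m)) + (m + 1 - 2) * (c + 0)) -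
          (m * δ * c + δ * ((m + 1) * L)) = (m * δ - x) / δ *
          ((r - x) * L - c * δ - (m + 1) / m * (L * δ) - x / m / m * L) := by
        field_simp
        ring
      have h1 : (m + 1) / m ≤ 2 := by
        rw [div_le_iff₀ hm]
        linarith
      have h2 : x / m / m ≤ δ := by
        rw [div_div, div_le_iff₀ (by positivity)]
        nlinarith
      have h3 := mul_le_mul_of_nonneg_right h1 (mul_pos hL hδ).le
      have h4 := mul_le_mul_of_nonneg_right h2 hL.le
      have h5 := mul_le_mul_of_nonneg_right hx hL.le
      have h6 := mul_le_mul_of_nonneg_right hm1 (mul_pos hL hδ).le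
      have : 0 ≤ (m * δ - x) / δ *
          ((r - x) * L - c * δ - (m + 1) / m * (L * δ) - x / m / m * L) :=
        mul_nonneg (div_nonneg (by linarith) hδ.le) (by linarith)
      linarith
    · rw [flow_eq, hS, Function.update_self, ← hmdef]
      field_simp
      ring

end Altruistic

theorem n_user_value_of_unilateral_altruism_unbounded
    (n : ℕ) (hn : 2 ≤ n) (r L : ℝ) (hr : 0 < r) (hL : 0 < L) (M : ℝ) (hM : 0 < M) :
    ∃ δ c β : ℝ, 0 < δ ∧ δ < L ∧ L < c ∧ c * δ < r * L ∧ β ∈ Set.Ioc (0 : ℝ) 1 ∧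
      ∃ q p : Fin n → ℝ,
        (∀ i, q i ∈ Set.Icc (0 : ℝ) r) ∧ (∀ i, p i ∈ Set.Icc (0 : ℝ) r) ∧
        -- q is a Nash equilibrium of the altruistic game (user `⟨0, _⟩` is altruistic)
        (∀ y ∈ Set.Icc (0 : ℝ) r,
          Jhat n r L δ c β ⟨0, by omega⟩ q ≤
            Jhat n r L δ c β ⟨0, by omega⟩ (Function.update q ⟨0, by omega⟩ y)) ∧
        (∀ j : Fin n, j ≠ ⟨0, by omega⟩ → ∀ y ∈ Set.Icc (0 : ℝ) r,
          J n r L δ c q j ≤ J n r L δ c (Function.update q j y) j) ∧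
        -- p is a Nash equilibrium of the selfish game
        (∀ i : Fin n, ∀ y ∈ Set.Icc (0 : ℝ) r,
          J n r L δ c p i ≤ J n r L δ c (Function.update p i y) i) ∧
        J n r L δ c p ⟨0, by omega⟩ > M * J n r L δ c q ⟨0, by omega⟩ := by
  have hn' : (2 : ℝ) ≤ n := by exact_mod_cast hn
  have hn0 : (0 : ℝ) < n := by linarith
  obtain ⟨δ, hδ, hδL, hδr, hδM⟩ : ∃ δ : ℝ, 0 < δ ∧ δ < L ∧ 4 * n * δ ≤ r ∧
      4 * n ^ 2 * M * δ ≤ r := by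
    refine ⟨min (L / 2) (min (r / (4 * n)) (r / (4 * n ^ 2 * M))), by positivity,
      (min_le_left _ _).trans_lt (by linarith), ?_, ?_⟩
    · rw [← le_div_iff₀' (by positivity)]
      exact (min_le_right _ _).trans (min_le_left _ _)
    · rw [← le_div_iff₀' (by positivity)]
      exact (min_le_right _ _).trans (min_le_right _ _)
  have hnδ : 2 * δ ≤ n * δ := mul_le_mul_of_nonneg_right hn' hδ.le
  have hc : r * L / (2 * δ) * δ = r * L / 2 := by field_simp
  have hrL : 0 < r * L := mul_pos hr hL
  have hx0 : 0 ≤ ((n : ℝ) - 1) * r / (2 * n) :=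
    div_nonneg (mul_nonneg (by linarith) hr.le) (by linarith)
  have hx1 : ((n : ℝ) - 1) * r / (2 * n) ≤ r := by
    rw [div_le_iff₀ (by positivity)]
    nlinarith
  refine ⟨δ, r * L / (2 * δ), 1, hδ, hδL, ?_, ?_, by norm_num,
    altruisticProfile n r δ ⟨0, by omega⟩, fun _ => r - ((n : ℝ) - 1) * r / (2 * n),
    ?_, ?_, ?_, ?_, ?_, ?_⟩
  · rw [lt_div_iff₀ (by positivity)]
    nlinarith
  · linarith
  · intro i
    unfold altruisticProfile
    split_ifs
    · exact ⟨hr.le, le_rfl⟩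
    · constructor <;> nlinarith
  · intro i
    constructor <;> linarith
  · intro y hy
    unfold Jhat
    rw [sub_self, zero_mul, zero_mul, zero_add, zero_add]
    refine mul_le_mul_of_nonneg_left (Finset.sum_le_sum fun j hj => ?_)
      (div_nonneg zero_le_one (by linarith))
    exact J_altruisticProfile_le_update_altruist n r L δ _ hn hL hδ (by nlinarith) _
      (Finset.ne_of_mem_erase hj) y hy
  · intro j hj y hy
    refine J_altruisticProfile_le_update_selfish n r L δ _ hn hL hδ _ (by positivity) ?_ hj y hy
    rw [hc]
    nlinarith
  · intro i y hy
    refine J_const_le_update n r L δ _ hn hL hδ _ ?_ i y hy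
    rw [hc]
    field_simp
    ring
  · rw [J_const n r L δ _ hn hL, J_altruisticProfile_self n r L δ _ hn hL hδ]
    have hmain : M * (r * (n * L)) ≤
        ((n : ℝ) - 1) * r / (2 * n) * (r * L / (2 * δ)) := by
      rw [div_mul_div_comm, le_div_iff₀ (by positivity)]
      have h2 : r * L * (4 * n ^ 2 * M * δ) ≤ r * L * r :=
        mul_le_mul_of_nonneg_left hδM (by positivity)
      have h3 : r * L * r * 1 ≤ r * L * r * ((n : ℝ) - 1) :=
        mul_le_mul_of_nonneg_left (by linarith) (by positivity)
      linarith
    linarith
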